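/- For every triangular number k, the binary representation of the triangular number t_{2^k - 1} contains exactly k ones; in particular, t_{2^k - 1} is very triangular. -/

import Mathlib

/-- The n-th triangular number. -/
def triangular (n : ℕ) : ℕ := n * (n + 1) / 2

/-- A natural number is triangular if it is `triangular n` for some `n`. -/
def IsTriangular (m : ℕ) : Prop := ∃ n : ℕ, triangular n = m

/-- The number of 1s in the binary representation of `m` (binary digit sum). -/
def binOnes (m : ℕ) : ℕ := (Nat.digits 2 m).sum

/-- A number is very triangular if it is triangular and its binary digit sum is triangular. -/
def IsVeryTriangular (m : ℕ) : Prop := IsTriangular m ∧ IsTriangular (binOnes m)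

theorem binOnes_zero : binOnes 0 = 0 := by simp [binOnes]

theorem binOnes_two_mul (n : ℕ) : binOnes (2 * n) = binOnes n := by
  rcases Nat.eq_zero_or_pos n with rfl | hn
  · rfl
  · simp [binOnes, Nat.digits_base_mul one_lt_two hn]

theorem binOnes_two_mul_add_one (n : ℕ) : binOnes (2 * n + 1) = binOnes n + 1 := by
  unfold binOnes
  rw [add_comm (2 * n), Nat.digits_add 2 one_lt_two 1 n one_lt_two (Or.inl one_ne_zero),
    List.sum_cons, add_comm]

theorem binOnes_two_pow_mul (j n : ℕ) : binOnes (2 ^ j * n) = binOnes n := by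
  induction j with
  | zero => simp
  | succ j ih => rw [pow_succ', mul_assoc, binOnes_two_mul, ih]

theorem binOnes_two_pow_sub_one (k : ℕ) : binOnes (2 ^ k - 1) = k := by
  induction k with
  | zero => exact binOnes_zero
  | succ k ih =>
    have h : 2 ^ (k + 1) - 1 = 2 * (2 ^ k - 1) + 1 := by
      have := Nat.one_le_two_pow (n := k)
      rw [pow_succ']
      omega
    rw [h, binOnes_two_mul_add_one, ih]

theorem triangular_two_pow_succ_sub_one (j : ℕ) :
    triangular (2 ^ (j + 1) - 1) = 2 ^ j * (2 ^ (j + 1) - 1) := by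
  have h : (2 ^ (j + 1) - 1) * 2 ^ (j + 1) = 2 * (2 ^ j * (2 ^ (j + 1) - 1)) := by
    rw [mul_comm, ← mul_assoc, ← pow_succ']
  rw [triangular, Nat.sub_add_cancel Nat.one_le_two_pow, h, Nat.mul_div_cancel_left _ two_pos]

theorem binOnes_triangular_two_pow_sub_one (k : ℕ) : binOnes (triangular (2 ^ k - 1)) = k := by
  cases k with
  | zero => exact binOnes_zero
  | succ j =>
    rw [triangular_two_pow_succ_sub_one, binOnes_two_pow_mul, binOnes_two_pow_sub_one]

theorem stmt3 (k : ℕ) (hk : IsTriangular k) :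
    binOnes (triangular (2 ^ k - 1)) = k ∧
      IsVeryTriangular (triangular (2 ^ k - 1)) := by
  have h := binOnes_triangular_two_pow_sub_one k
  exact ⟨h, ⟨_, rfl⟩, h.symm ▸ hk⟩
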